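/- arXiv:1501.03624 — 3 statements merged into one kernel-verified Lean document; each statement's English description precedes it below -/
import Mathlib

section
/- For any constants H0, m, M, g, L, s0 > 0, there exists a twice continuously differentiable function s : [0,L] → ℝ satisfying H0·s''(x) = (M + m·√(1 + s'(x)²))·g for all x ∈ [0,L] and s(0) = s(L) = s0. -/
open Set

/-- An autonomous scalar equation `u' = 1 / h u` with `h` even, continuous and bounded below by a
positive constant has a global odd solution. -/
theorem exists_odd_hasDerivAt_inv {h : ℝ → ℝ} {c : ℝ} (hcont : Continuous h)
    (heven : ∀ x, h (-x) = h x) (hc : 0 < c) (hle : ∀ x, c ≤ h x) :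
    ∃ u : ℝ → ℝ, (∀ x, u (-x) = -u x) ∧ ∀ x, HasDerivAt u (h (u x))⁻¹ x := by
  set G : ℝ → ℝ := fun x => ∫ t in (0 : ℝ)..x, h t with hG
  have hGd : ∀ x, HasDerivAt G (h x) x := fun x =>
    intervalIntegral.integral_hasDerivAt_right (hcont.intervalIntegrable _ _)
      hcont.stronglyMeasurable.stronglyMeasurableAtFilter hcont.continuousAt
  have hG0 : G 0 = 0 := by simp [hG]
  have hGodd : ∀ x, G (-x) = -G x := fun x => by
    have key := intervalIntegral.integral_comp_neg (a := 0) (b := x) h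
    simp only [heven, neg_zero] at key
    simp only [hG]
    rw [key, intervalIntegral.integral_symm]
  have hGmono : StrictMono G := strictMono_of_hasDerivAt_pos hGd fun x => hc.trans_le (hle x)
  have hGc : Continuous G := continuous_iff_continuousAt.2 fun x => (hGd x).continuousAt
  have hsub : Monotone fun x => G x - c * x := by
    have hd : ∀ x, HasDerivAt (fun x => G x - c * x) (h x - c * 1) x := fun x =>
      (hGd x).sub ((hasDerivAt_id x).const_mul c)
    refine monotone_of_deriv_nonneg (fun x => (hd x).differentiableAt) fun x => ?_
    rw [(hd x).deriv]
    linarith [hle x]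
  have htop : Filter.Tendsto G Filter.atTop Filter.atTop := by
    refine Filter.tendsto_atTop_mono' _ ?_ (Filter.tendsto_id.const_mul_atTop hc)
    filter_upwards [Filter.eventually_ge_atTop 0] with x hx
    have := hsub hx
    simp only [hG0, id] at this ⊢
    linarith
  have hbot : Filter.Tendsto G Filter.atBot Filter.atBot := by
    refine Filter.tendsto_atBot_mono' _ ?_ (Filter.tendsto_id.const_mul_atBot hc)
    filter_upwards [Filter.eventually_le_atBot 0] with x hx
    have := hsub hx
    simp only [hG0, id] at this ⊢
    linarith
  let e := hGmono.orderIsoOfSurjective G (hGc.surjective htop hbot)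
  have he : ∀ y, G (e.symm y) = y := fun y => e.apply_symm_apply y
  refine ⟨e.symm, fun x => hGmono.injective ?_, fun x => ?_⟩
  · rw [he, hGodd, he]
  · exact (hGd _).of_local_left_inverse e.symm.continuous.continuousAt
      (hc.trans_le (hle _)).ne' (Filter.Eventually.of_forall he)

/-- The slope equation `p' = a + b √(1 + p²)` with `a, b > 0` has a global odd solution. -/
theorem exists_odd_hasDerivAt_add_mul_sqrt {a b : ℝ} (ha : 0 < a) (hb : 0 < b) :
    ∃ p : ℝ → ℝ, (∀ x, p (-x) = -p x) ∧
      ∀ x, HasDerivAt p (a + b * Real.sqrt (1 + p x ^ 2)) x := by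
  have hpos : ∀ x, 0 < a + b * Real.cosh x := fun x => by
    have := Real.cosh_pos x
    positivity
  obtain ⟨u, hodd, hu⟩ := exists_odd_hasDerivAt_inv
    (h := fun x => Real.cosh x / (a + b * Real.cosh x)) (c := 1 / (a + b))
    (by
      refine Real.continuous_cosh.div ?_ fun x => (hpos x).ne'
      exact continuous_const.add (continuous_const.mul Real.continuous_cosh))
    (fun x => by simp only [Real.cosh_neg]) (by positivity)
    (fun x => by
      rw [div_le_div_iff₀ (by positivity) (hpos x)]
      nlinarith [Real.one_le_cosh x])
  refine ⟨fun x => Real.sinh (u x), fun x => by simp only [hodd, Real.sinh_neg], fun x => ?_⟩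
  have hsqrt : Real.sqrt (1 + Real.sinh (u x) ^ 2) = Real.cosh (u x) := by
    rw [add_comm, ← Real.cosh_sq, Real.sqrt_sq (Real.cosh_pos _).le]
  convert (hu x).sinh using 1
  have h1 := (Real.cosh_pos (u x)).ne'
  have h2 := (hpos (u x)).ne'
  rw [hsqrt]
  field_simp

theorem cable_bvp_exists
    (H0 m M g L s0 : ℝ)
    (hH0 : 0 < H0) (hm : 0 < m) (hM : 0 < M) (hg : 0 < g) (hL : 0 < L) (hs0 : 0 < s0) :
    ∃ s : ℝ → ℝ, ContDiffOn ℝ 2 s (Icc 0 L) ∧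
      (∀ x ∈ Icc 0 L,
        H0 * deriv (deriv s) x = (M + m * Real.sqrt (1 + (deriv s x) ^ 2)) * g) ∧
      s 0 = s0 ∧ s L = s0 := by
  obtain ⟨p, hodd, hp⟩ := exists_odd_hasDerivAt_add_mul_sqrt
    (a := M * g / H0) (b := m * g / H0) (by positivity) (by positivity)
  have hpc : Continuous p := continuous_iff_continuousAt.2 fun x => (hp x).continuousAt
  set q : ℝ → ℝ := fun x => p (x - L / 2) with hq
  have hqd : ∀ x, HasDerivAt q (M * g / H0 + m * g / H0 * Real.sqrt (1 + q x ^ 2)) x :=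
    fun x => (hp _).comp_sub_const x (L / 2)
  have hqc : Continuous q := hpc.comp (continuous_id.sub continuous_const)
  set s : ℝ → ℝ := fun x => s0 + ∫ t in (0 : ℝ)..x, q t with hs
  have hsd : ∀ x, HasDerivAt s (q x) x := fun x =>
    (intervalIntegral.integral_hasDerivAt_right (hqc.intervalIntegrable _ _)
      hqc.stronglyMeasurable.stronglyMeasurableAtFilter hqc.continuousAt).const_add s0
  have hds : deriv s = q := funext fun x => (hsd x).deriv
  have hdq : deriv q = fun x => M * g / H0 + m * g / H0 * Real.sqrt (1 + q x ^ 2) :=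
    funext fun x => (hqd x).deriv
  have hint : ∫ t in (0 : ℝ)..L, q t = 0 := by
    have hrefl : ∀ t, q (L - t) = -q t := fun t => by
      simp only [hq]
      rw [← hodd]
      congr 1
      ring
    have key := intervalIntegral.integral_comp_sub_left (a := 0) (b := L) q L
    simp only [hrefl, sub_self, sub_zero, intervalIntegral.integral_neg] at key
    linarith
  refine ⟨s, ContDiff.contDiffOn ?_, fun x _ => ?_, by simp [hs], by simp [hs, hint]⟩
  · rw [show (2 : WithTop ℕ∞) = 1 + 1 from one_add_one_eq_two.symm, contDiff_succ_iff_deriv]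
    refine ⟨fun x => (hsd x).differentiableAt, by simp, ?_⟩
    rw [hds, contDiff_one_iff_deriv, hdq]
    exact ⟨fun x => (hqd x).differentiableAt, by fun_prop⟩
  · rw [hds, hdq]
    field_simp
end

section
/- For any constants H0, m, M, g, L, s0 > 0, if s₁ and s₂ are two twice continuously differentiable functions on [0,L] both satisfying H0·s''(x) = (M + m·√(1 + s'(x)²))·g on [0,L] and s(0) = s(L) = s0, then s₁(x) = s₂(x) for all x ∈ [0,L]. -/
open Set

lemma sqrt_one_add_sq_le (x y : ℝ) :
    Real.sqrt (1 + x ^ 2) ≤ Real.sqrt (1 + y ^ 2) + |x - y| := by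
  have hy : |y| ≤ Real.sqrt (1 + y ^ 2) := Real.abs_le_sqrt (by linarith)
  have hsq : Real.sqrt (1 + y ^ 2) ^ 2 = 1 + y ^ 2 := Real.sq_sqrt (by positivity)
  have hyx : y * (x - y) ≤ |y| * |x - y| := by
    rw [← abs_mul]; exact le_abs_self _
  have hmul := mul_le_mul_of_nonneg_right hy (abs_nonneg (x - y))
  rw [Real.sqrt_le_left (by positivity)]
  nlinarith [sq_abs (x - y)]

lemma lipschitzWith_sqrt_one_add_sq : LipschitzWith 1 fun x : ℝ => Real.sqrt (1 + x ^ 2) :=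
  LipschitzWith.of_le_add fun x y => by
    simpa [Real.dist_eq] using sqrt_one_add_sq_le x y

lemma exists_lipschitzWith_cable (H0 m M g : ℝ) :
    ∃ K, LipschitzWith K fun p : ℝ => (M + m * Real.sqrt (1 + p ^ 2)) * g / H0 := by
  refine ⟨‖m * g / H0‖₊, LipschitzWith.of_dist_le_mul fun x y => ?_⟩
  have h := lipschitzWith_sqrt_one_add_sq.dist_le_mul x y
  rw [NNReal.coe_one, one_mul, Real.dist_eq] at h
  rw [Real.dist_eq, coe_nnnorm, Real.norm_eq_abs]
  calc _ = |m * g / H0 * (Real.sqrt (1 + x ^ 2) - Real.sqrt (1 + y ^ 2))| := by congr 1; ring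
    _ ≤ _ := by rw [abs_mul]; gcongr

/-- The right-hand side of the cable equation never vanishes, so a solution in the sense of `deriv`
has a genuine second derivative at every point. -/
lemma hasDerivAt_deriv_of_cable {H0 m M g x : ℝ} {s : ℝ → ℝ}
    (hH0 : 0 < H0) (hm : 0 < m) (hM : 0 < M) (hg : 0 < g)
    (hode : H0 * deriv (deriv s) x = (M + m * Real.sqrt (1 + (deriv s x) ^ 2)) * g) :
    HasDerivAt (deriv s) ((M + m * Real.sqrt (1 + (deriv s x) ^ 2)) * g / H0) x := by
  have hpos : 0 < (M + m * Real.sqrt (1 + (deriv s x) ^ 2)) * g := by positivity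
  have hne : deriv (deriv s) x ≠ 0 := by
    intro h
    rw [h, mul_zero] at hode
    exact hpos.ne hode
  rw [← hode, mul_div_cancel_left₀ _ hH0.ne']
  exact (differentiableAt_of_deriv_ne_zero hne).hasDerivAt

theorem cable_bvp_unique
    (H0 m M g L s0 : ℝ)
    (hH0 : 0 < H0) (hm : 0 < m) (hM : 0 < M) (hg : 0 < g) (hL : 0 < L) (hs0 : 0 < s0)
    (s₁ s₂ : ℝ → ℝ)
    (hs₁ : ContDiffOn ℝ 2 s₁ (Icc 0 L))
    (hode₁ : ∀ x ∈ Icc 0 L,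
      H0 * deriv (deriv s₁) x = (M + m * Real.sqrt (1 + (deriv s₁ x) ^ 2)) * g)
    (hbc₁ : s₁ 0 = s0 ∧ s₁ L = s0)
    (hs₂ : ContDiffOn ℝ 2 s₂ (Icc 0 L))
    (hode₂ : ∀ x ∈ Icc 0 L,
      H0 * deriv (deriv s₂) x = (M + m * Real.sqrt (1 + (deriv s₂ x) ^ 2)) * g)
    (hbc₂ : s₂ 0 = s0 ∧ s₂ L = s0) :
    ∀ x ∈ Icc 0 L, s₁ x = s₂ x := by
  have hasDeriv {s : ℝ → ℝ} (hs : ContDiffOn ℝ 2 s (Icc 0 L)) {x : ℝ} (hx : x ∈ Ioo 0 L) :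
      HasDerivAt s (deriv s x) x :=
    ((hs.contDiffAt (Icc_mem_nhds hx.1 hx.2)).differentiableAt (by norm_num)).hasDerivAt
  have hd₁ x (hx : x ∈ Icc 0 L) := hasDerivAt_deriv_of_cable hH0 hm hM hg (hode₁ x hx)
  have hd₂ x (hx : x ∈ Icc 0 L) := hasDerivAt_deriv_of_cable hH0 hm hM hg (hode₂ x hx)
  have hdiff x (hx : x ∈ Ioo 0 L) : HasDerivAt (s₁ - s₂) (deriv s₁ x - deriv s₂ x) x :=
    (hasDeriv hs₁ hx).sub (hasDeriv hs₂ hx)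
  have hcont : ContinuousOn (s₁ - s₂) (Icc 0 L) := hs₁.continuousOn.sub hs₂.continuousOn
  have h0 : (s₁ - s₂) 0 = 0 := by simp [hbc₁.1, hbc₂.1]
  have hL0 : (s₁ - s₂) L = 0 := by simp [hbc₁.2, hbc₂.2]
  obtain ⟨ξ, hξ, hξ0⟩ := exists_hasDerivAt_eq_zero hL hcont (h0.trans hL0.symm) hdiff
  obtain ⟨K, hK⟩ := exists_lipschitzWith_cable H0 m M g
  have heq : EqOn (deriv s₁) (deriv s₂) (Icc 0 L) :=
    ODE_solution_unique_of_mem_Icc (v := fun _ p => (M + m * Real.sqrt (1 + p ^ 2)) * g / H0)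
      (s := fun _ => univ) (fun _ _ => hK.lipschitzOnWith) hξ
      (fun x hx => (hd₁ x hx).continuousAt.continuousWithinAt)
      (fun x hx => hd₁ x (Ioo_subset_Icc_self hx)) (fun _ _ => mem_univ _)
      (fun x hx => (hd₂ x hx).continuousAt.continuousWithinAt)
      (fun x hx => hd₂ x (Ioo_subset_Icc_self hx)) (fun _ _ => mem_univ _)
      (sub_eq_zero.mp hξ0)
  intro x hx
  rcases hx.1.eq_or_lt with rfl | hx0
  · rw [hbc₁.1, hbc₂.1]
  obtain ⟨c, hc, hslope⟩ := exists_hasDerivAt_eq_slope (s₁ - s₂) _ hx0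
    (hcont.mono (Icc_subset_Icc_right hx.2)) fun y hy => hdiff y ⟨hy.1, hy.2.trans_le hx.2⟩
  rw [heq ⟨hc.1.le, hc.2.le.trans hx.2⟩, sub_self, h0, sub_zero, sub_zero, eq_comm,
    div_eq_zero_iff, or_iff_left hx0.ne'] at hslope
  exact sub_eq_zero.mp hslope
end

section
/- For any constants H0, m, M, g, L, s0 > 0, the solution s of the boundary value problem H0·s''(x) = (M + m·√(1 + s'(x)²))·g on [0,L] with s(0) = s(L) = s0 is strictly decreasing on [0, L/2], strictly increasing on [L/2, L], attains its minimum at x = L/2, and satisfies s(x) < s0 for all x ∈ (0,L). -/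
open Set

theorem abs_sqrt_one_add_sq_sub_le (a b : ℝ) :
    |Real.sqrt (1 + a ^ 2) - Real.sqrt (1 + b ^ 2)| ≤ |a - b| := by
  have ha : 0 ≤ 1 + a ^ 2 := by positivity
  have hb : 0 ≤ 1 + b ^ 2 := by positivity
  rw [← sq_le_sq]
  have h : 1 + a * b ≤ Real.sqrt (1 + a ^ 2) * Real.sqrt (1 + b ^ 2) := by
    rw [← Real.sqrt_mul ha]
    apply Real.le_sqrt_of_sq_le
    nlinarith [sq_nonneg (a - b)]
  nlinarith [Real.sq_sqrt ha, Real.sq_sqrt hb]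

/-- The right-hand side of the cable equation is a Lipschitz function of the slope. -/
theorem lipschitzWith_cable_rhs (c k : ℝ) :
    LipschitzWith (Real.nnabs k) (fun v : ℝ => c + k * Real.sqrt (1 + v ^ 2)) := by
  refine LipschitzWith.of_dist_le_mul fun a b => ?_
  rw [Real.dist_eq, Real.dist_eq, add_sub_add_left_eq_sub, ← mul_sub, abs_mul, Real.coe_nnabs]
  exact mul_le_mul_of_nonneg_left (abs_sqrt_one_add_sq_sub_le a b) (abs_nonneg k)

/-- A solution of an autonomous equation with even Lipschitz right-hand side which agrees
somewhere with its odd reflection about `L / 2` vanishes at `L / 2`. -/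
theorem eq_zero_at_midpoint_of_even_ode {F v : ℝ → ℝ} {K : NNReal} {L c : ℝ}
    (hF : LipschitzWith K F) (heven : ∀ y, F (-y) = F y)
    (hv : ∀ x ∈ Ioo 0 L, HasDerivAt v (F (v x)) x)
    (hc : c ∈ Ioo 0 L) (hvc : v c = -v (L - c)) : v (L / 2) = 0 := by
  have hL : 0 < L := hc.1.trans hc.2
  have key : EqOn v (fun x => -v (L - x)) (Ioo 0 L) := by
    refine ODE_solution_unique_of_mem_Ioo (v := fun _ => F) (s := fun _ => univ) (K := K)
      (fun _ _ => hF.lipschitzOnWith) hc (fun x hx => ⟨hv x hx, mem_univ _⟩)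
      (fun x hx => ⟨?_, mem_univ _⟩) hvc
    have h := (hv (L - x) ⟨by linarith [hx.2], by linarith [hx.1]⟩).comp_const_sub L x
    simpa [heven] using h.fun_neg
  have h := key (show L / 2 ∈ Ioo 0 L from ⟨by linarith, by linarith⟩)
  simp only [sub_half] at h
  linarith

theorem cable_bvp_monotonicity
    (H0 m M g L s0 : ℝ)
    (hH0 : 0 < H0) (hm : 0 < m) (hM : 0 < M) (hg : 0 < g) (hL : 0 < L) (hs0 : 0 < s0)
    (s : ℝ → ℝ)
    (hs : ContDiffOn ℝ 2 s (Icc 0 L))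
    (hode : ∀ x ∈ Icc 0 L,
      H0 * deriv (deriv s) x = (M + m * Real.sqrt (1 + (deriv s x) ^ 2)) * g)
    (hbc : s 0 = s0 ∧ s L = s0) :
    StrictAntiOn s (Icc 0 (L / 2)) ∧
    StrictMonoOn s (Icc (L / 2) L) ∧
    (∀ x ∈ Icc 0 L, s (L / 2) ≤ s x) ∧
    (∀ x ∈ Ioo 0 L, s x < s0) := by
  obtain ⟨hs_left, hs_right⟩ := hbc
  have hpos : ∀ x ∈ Icc 0 L, 0 < deriv (deriv s) x := fun x hx => by
    have h : 0 < H0 * deriv (deriv s) x := by rw [hode x hx]; positivity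
    exact pos_of_mul_pos_right h hH0.le
  have hv : ∀ x ∈ Icc 0 L, DifferentiableAt ℝ (deriv s) x := fun x hx =>
    differentiableAt_of_deriv_ne_zero (hpos x hx).ne'
  have hmono : StrictMonoOn (deriv s) (Icc 0 L) :=
    strictMonoOn_of_deriv_pos (convex_Icc 0 L)
      (fun x hx => (hv x hx).continuousAt.continuousWithinAt)
      (fun x hx => hpos x (interior_subset hx))
  have hcont : ContinuousOn s (Icc 0 L) := hs.continuousOn
  have hdiff : ∀ x ∈ Ioo 0 L, HasDerivAt s (deriv s x) x := fun x hx =>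
    ((hs.differentiableOn two_ne_zero).differentiableAt (Icc_mem_nhds hx.1 hx.2)).hasDerivAt
  have hmid : deriv s (L / 2) = 0 := by
    have hmaps : MapsTo (fun x => L - x) (Icc 0 L) (Icc 0 L) := fun x hx =>
      ⟨by linarith [hx.2], by linarith [hx.1]⟩
    obtain ⟨c, hc, hc0⟩ := exists_hasDerivAt_eq_zero (f := fun x => s x - s (L - x))
      (f' := fun x => deriv s x - -deriv s (L - x)) hL
      (hcont.sub (hcont.comp (by fun_prop) hmaps)) (by simp [hs_left, hs_right])
      (fun x hx => (hdiff x hx).sub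
        ((hdiff (L - x) ⟨by linarith [hx.2], by linarith [hx.1]⟩).comp_const_sub L x))
    refine eq_zero_at_midpoint_of_even_ode (lipschitzWith_cable_rhs (M * g / H0) (m * g / H0))
      (fun y => by simp) (fun x hx => ?_) hc (sub_eq_zero.mp hc0)
    have hx' := Ioo_subset_Icc_self hx
    have hslope : deriv (deriv s) x =
        M * g / H0 + m * g / H0 * Real.sqrt (1 + (deriv s x) ^ 2) := by
      have h := hode x hx'
      field_simp
      linarith
    exact hslope ▸ (hv x hx').hasDerivAt
  have hmid_mem : L / 2 ∈ Icc 0 L := ⟨by linarith, by linarith⟩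
  have hanti : StrictAntiOn s (Icc 0 (L / 2)) := by
    refine strictAntiOn_of_deriv_neg (convex_Icc _ _)
      (hcont.mono (Icc_subset_Icc_right hmid_mem.2)) fun x hx => ?_
    rw [interior_Icc] at hx
    rw [← hmid]
    exact hmono ⟨hx.1.le, hx.2.le.trans hmid_mem.2⟩ hmid_mem hx.2
  have hinc : StrictMonoOn s (Icc (L / 2) L) := by
    refine strictMonoOn_of_deriv_pos (convex_Icc _ _)
      (hcont.mono (Icc_subset_Icc_left hmid_mem.1)) fun x hx => ?_
    rw [interior_Icc] at hx
    rw [← hmid]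
    exact hmono hmid_mem ⟨hmid_mem.1.trans hx.1.le, hx.2.le⟩ hx.1
  refine ⟨hanti, hinc, fun x hx => ?_, fun x hx => ?_⟩
  · rcases le_total x (L / 2) with h | h
    · exact hanti.antitoneOn ⟨hx.1, h⟩ (right_mem_Icc.mpr hmid_mem.1) h
    · exact hinc.monotoneOn (left_mem_Icc.mpr hmid_mem.2) ⟨h, hx.2⟩ h
  · rcases le_total x (L / 2) with h | h
    · exact hs_left ▸ hanti (left_mem_Icc.mpr hmid_mem.1) ⟨hx.1.le, h⟩ hx.1
    · exact hs_right ▸ hinc ⟨h, hx.2.le⟩ (right_mem_Icc.mpr hmid_mem.2) hx.2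
end
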